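/- arXiv:2307.14350 — 5 statements merged into one kernel-verified Lean document; each statement's English description precedes it below -/
import Mathlib

section
/- The optimal values of Problems (P2) and (P3) coincide: the supremum, over all (P2)-points (N, t, π), of the objective ∑_k ∑_n π_{k,n}, equals the supremum, over all (P3)-points (t, π), of the objective ∑_k ∑_n π_{k,n} (with the empty schedule, of objective 0, allowed in both cases; the suprema are taken in ℕ). -/
/-- The maximum deadline plus the maximum possible inference delay:
`Ξ = max_k T^d_k + (a·K + b)`. -/
noncomputable def Xi (K : ℕ) (hK : 0 < K) (a b : ℝ) (Td : Fin K → ℝ) : ℝ :=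
  Finset.univ.sup' (Finset.univ_nonempty_iff.mpr ⟨⟨0, hK⟩⟩) Td + (a * K + b)

/-- Inference delay of a batch of `m` tasks: `d(m) = a·m + b` for `m ≥ 1`, `d(0) = 0`. -/
noncomputable def dDelay (a b : ℝ) (m : ℕ) : ℝ := if m = 0 then 0 else a * m + b

/-- The objective: the number of scheduled tasks `∑_k ∑_{n<N} π_{k,n}`. -/
def objective (K N : ℕ) (π : Fin K → ℕ → ℕ) : ℕ :=
  ∑ k : Fin K, ∑ n ∈ Finset.range N, π k n

/-- A (P2)-point: batch count `N` with `1 ≤ N ≤ K`, batch starting times `t`, and a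
`{0,1}`-valued task-batch association `π` (batches indexed by `0,…,N-1`) satisfying
(c1)–(c6), with every batch nonempty. -/
def IsP2 (K : ℕ) (a b B : ℝ) (Ta Td ℓ r : Fin K → ℝ)
    (N : ℕ) (t : ℕ → ℝ) (π : Fin K → ℕ → ℕ) : Prop :=
  1 ≤ N ∧ N ≤ K ∧
  (∀ k n, π k n ≤ 1) ∧
  (∀ k, ∑ n ∈ Finset.range N, π k n ≤ 1) ∧
  (∀ n < N, 1 ≤ ∑ k : Fin K, π k n) ∧
  (∀ k : Fin K, ∀ n < N, π k n = 1 → Ta k < t n) ∧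
  (∀ k : Fin K, ∀ n < N, π k n = 1 →
    t n + (a * (∑ k' : Fin K, (π k' n : ℝ)) + b) ≤ Td k) ∧
  (∀ n, n + 1 < N →
    t n + (a * (∑ k' : Fin K, (π k' n : ℝ)) + b) ≤ t (n + 1)) ∧
  (∑ k : Fin K, ∑ n ∈ Finset.range N,
      (π k n : ℝ) * ℓ k / (r k * (t n - Ta k)) ≤ B)

/-- A (P3)-point: `N = K` batches, some possibly empty, satisfying (c1), (c3),
(c4'), (c5'), (c6). -/
def IsP3 (K : ℕ) (hK : 0 < K) (a b B : ℝ) (Ta Td ℓ r : Fin K → ℝ)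
    (t : ℕ → ℝ) (π : Fin K → ℕ → ℕ) : Prop :=
  (∀ k n, π k n ≤ 1) ∧
  (∀ k, ∑ n ∈ Finset.range K, π k n ≤ 1) ∧
  (∀ k : Fin K, ∀ n < K, π k n = 1 → Ta k < t n) ∧
  (∀ k : Fin K, ∀ n < K,
    t n + dDelay a b (∑ k' : Fin K, π k' n) ≤
      Td k + (1 - (π k n : ℝ)) * Xi K hK a b Td) ∧
  (∀ n, n + 1 < K →
    t n + dDelay a b (∑ k' : Fin K, π k' n) ≤ t (n + 1)) ∧
  (∑ k : Fin K, ∑ n ∈ Finset.range K,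
      (π k n : ℝ) * ℓ k / (r k * (t n - Ta k)) ≤ B)

/-- The increasing enumeration of a finite set of naturals by an initial segment. -/
theorem exists_strictMonoOn_image_range (S : Finset ℕ) :
    ∃ σ : ℕ → ℕ, StrictMonoOn σ (Set.Iio S.card) ∧ (Finset.range S.card).image σ = S := by
  have hf : {x | x ∈ S}.Finite := S.finite_toSet
  have hcard : hf.toFinset.card = S.card := by
    congr 1
    ext x
    simp
  refine ⟨Nat.nth (· ∈ S), ?_, ?_⟩
  · rw [← hcard]
    exact Nat.nth_strictMonoOn hf
  · apply Finset.coe_injective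
    rw [Finset.coe_image, Finset.coe_range, ← hcard]
    exact Nat.image_nth_Iio_card hf

theorem sum_range_comp_of_image_eq {M : Type*} [AddCommMonoid M] {S : Finset ℕ} {σ : ℕ → ℕ}
    {K : ℕ} (hmono : StrictMonoOn σ (Set.Iio S.card))
    (himage : (Finset.range S.card).image σ = S) (hS : S ⊆ Finset.range K) (f : ℕ → M)
    (hf : ∀ n < K, n ∉ S → f n = 0) :
    ∑ i ∈ Finset.range S.card, f (σ i) = ∑ n ∈ Finset.range K, f n := by
  have hinj : Set.InjOn σ (Finset.range S.card) := by
    rw [Finset.coe_range]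
    exact hmono.injOn
  rw [← Finset.sum_image hinj, himage]
  exact Finset.sum_subset hS fun n hn hnS => hf n (Finset.mem_range.mp hn) hnS

theorem dDelay_nonneg {a b : ℝ} (ha : 0 < a) (hb : 0 < b) (m : ℕ) : 0 ≤ dDelay a b m := by
  unfold dDelay
  split_ifs <;> positivity

theorem dDelay_sum_of_pos {K : ℕ} {a b : ℝ} (f : Fin K → ℕ) (h : 1 ≤ ∑ k, f k) :
    dDelay a b (∑ k, f k) = a * (∑ k, (f k : ℝ)) + b := by
  rw [dDelay, if_neg (by omega), Nat.cast_sum]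

/-- A nonempty (P2)-schedule extends to a (P3)-schedule by appending empty batches that start
when the last batch finishes. -/
theorem IsP2.exists_isP3 {K : ℕ} (hK : 0 < K) {a b B : ℝ} (ha : 0 < a) (hb : 0 < b)
    {Ta Td ℓ r : Fin K → ℝ} (hTa : ∀ k, 0 ≤ Ta k) (hTaTd : ∀ k, Ta k < Td k)
    {N : ℕ} {t : ℕ → ℝ} {π : Fin K → ℕ → ℕ} (h : IsP2 K a b B Ta Td ℓ r N t π) :
    ∃ t' π', IsP3 K hK a b B Ta Td ℓ r t' π' ∧ objective K K π' = objective K N π := by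
  obtain ⟨hN1, hNK, h01, hc1, hc2, hc3, hc4, hc5, hc6⟩ := h
  set d : ℕ → ℝ := fun n => a * (∑ k, (π k n : ℝ)) + b
  have hXi : ∀ x k, (∃ k₀, x ≤ Td k₀) → x ≤ Td k + Xi K hK a b Td := by
    rintro x k ⟨k₀, hx⟩
    have hsup := Finset.le_sup' Td (Finset.mem_univ k₀)
    have hk : 0 < Td k := (hTa k).trans_lt (hTaTd k)
    have hpos : 0 < a * (K : ℝ) + b := by positivity
    unfold Xi
    linarith
  have hfinish : ∀ n < N, ∃ k₀, t n + d n ≤ Td k₀ := by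
    intro n hn
    obtain ⟨k₀, -, hk₀⟩ := Finset.exists_ne_zero_of_sum_ne_zero
      (Nat.one_le_iff_ne_zero.mp (hc2 n hn))
    have := h01 k₀ n
    exact ⟨k₀, hc4 k₀ n hn (by omega)⟩
  have hsum {M : Type} [AddCommMonoid M] (f g : ℕ → M) (hlt : ∀ n < N, f n = g n)
      (hge : ∀ n, N ≤ n → f n = 0) :
      ∑ n ∈ Finset.range K, f n = ∑ n ∈ Finset.range N, g n := by
    rw [← Finset.sum_subset (Finset.range_mono hNK) fun n _ hn => hge n (by simpa using hn)]
    exact Finset.sum_congr rfl fun n hn => hlt n (Finset.mem_range.mp hn)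
  let t' : ℕ → ℝ := fun n => if n < N then t n else t (N - 1) + d (N - 1)
  let π' : Fin K → ℕ → ℕ := fun k n => if n < N then π k n else 0
  have ht'lt : ∀ n < N, t' n = t n := fun n hn => if_pos hn
  have ht'ge : ∀ n, N ≤ n → t' n = t (N - 1) + d (N - 1) := fun n hn => if_neg (by omega)
  have hπ'lt : ∀ k, ∀ n < N, π' k n = π k n := fun k n hn => if_pos hn
  have hπ'ge : ∀ k n, N ≤ n → π' k n = 0 := fun k n hn => if_neg (by omega)
  have hdlt : ∀ n < N, dDelay a b (∑ k, π' k n) = d n := by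
    intro n hn
    rw [Finset.sum_congr rfl fun k _ => hπ'lt k n hn, dDelay_sum_of_pos _ (hc2 n hn)]
  have hdge : ∀ n, N ≤ n → dDelay a b (∑ k, π' k n) = 0 := by
    intro n hn
    simp [hπ'ge _ n hn, dDelay]
  have hπsum : ∀ k, ∑ n ∈ Finset.range K, π' k n = ∑ n ∈ Finset.range N, π k n :=
    fun k => hsum _ _ (hπ'lt k) (hπ'ge k)
  refine ⟨t', π', ⟨?_, ?_, ?_, ?_, ?_, ?_⟩, Finset.sum_congr rfl fun k _ => hπsum k⟩
  · intro k n
    rcases lt_or_ge n N with hn | hn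
    · simpa [hπ'lt k n hn] using h01 k n
    · simp [hπ'ge k n hn]
  · intro k
    rw [hπsum]
    exact hc1 k
  · intro k n _ hkn
    rcases lt_or_ge n N with hn | hn
    · rw [ht'lt n hn]
      rw [hπ'lt k n hn] at hkn
      exact hc3 k n hn hkn
    · rw [hπ'ge k n hn] at hkn
      omega
  · intro k n _
    rcases lt_or_ge n N with hn | hn
    · rw [ht'lt n hn, hdlt n hn, hπ'lt k n hn]
      rcases Nat.le_one_iff_eq_zero_or_eq_one.mp (h01 k n) with h0 | h1
      · simpa [h0] using hXi _ k (hfinish n hn)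
      · simpa [h1] using hc4 k n hn h1
    · rw [ht'ge n hn, hdge n hn, hπ'ge k n hn]
      simpa using hXi _ k (hfinish (N - 1) (by omega))
  · intro n _
    rcases lt_trichotomy (n + 1) N with hn | hn | hn
    · rw [ht'lt n (by omega), hdlt n (by omega), ht'lt (n + 1) hn]
      exact hc5 n hn
    · rw [ht'lt n (by omega), hdlt n (by omega), ht'ge (n + 1) hn.ge, ← hn, Nat.add_sub_cancel]
    · rw [ht'ge n (by omega), hdge n (by omega), ht'ge (n + 1) (by omega), add_zero]
  · refine le_of_eq_of_le (Finset.sum_congr rfl fun k _ => hsum _ _ ?_ ?_) hc6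
    · intro n hn
      rw [ht'lt n hn, hπ'lt k n hn]
    · intro n hn
      simp [hπ'ge k n hn]

/-- A (P3)-schedule with at least one scheduled task becomes a (P2)-schedule once its empty
batches are removed. -/
theorem IsP3.exists_isP2 {K : ℕ} {hK : 0 < K} {a b B : ℝ} (ha : 0 < a) (hb : 0 < b)
    {Ta Td ℓ r : Fin K → ℝ} {t : ℕ → ℝ} {π : Fin K → ℕ → ℕ}
    (h : IsP3 K hK a b B Ta Td ℓ r t π) (hobj : objective K K π ≠ 0) :
    ∃ N t' π', IsP2 K a b B Ta Td ℓ r N t' π' ∧ objective K N π' = objective K K π := by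
  obtain ⟨h01, hc1, hc3, hc4, hc5, hc6⟩ := h
  set S := (Finset.range K).filter fun n => 1 ≤ ∑ k, π k n
  have hSK : S ⊆ Finset.range K := Finset.filter_subset _ _
  have hzero : ∀ k, ∀ n < K, n ∉ S → π k n = 0 := by
    intro k n hn hnS
    have hnot : ¬ 1 ≤ ∑ k, π k n := fun hle =>
      hnS (Finset.mem_filter.mpr ⟨Finset.mem_range.mpr hn, hle⟩)
    have := Finset.single_le_sum (f := fun k => π k n) (fun _ _ => Nat.zero_le _)
      (Finset.mem_univ k)
    omega
  have hcardpos : 1 ≤ S.card := by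
    rw [Nat.one_le_iff_ne_zero, Finset.card_ne_zero, Finset.nonempty_iff_ne_empty]
    intro hempty
    refine hobj (Finset.sum_eq_zero fun k _ => Finset.sum_eq_zero fun n hn => ?_)
    exact hzero k n (Finset.mem_range.mp hn) (by simp [hempty])
  obtain ⟨σ, hmono, himage⟩ := exists_strictMonoOn_image_range S
  have hσS : ∀ i < S.card, σ i ∈ S := by
    intro i hi
    have := Finset.mem_image_of_mem σ (Finset.mem_range.mpr hi)
    rwa [himage] at this
  have hσK : ∀ i < S.card, σ i < K := fun i hi => Finset.mem_range.mp (hSK (hσS i hi))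
  have hσpos : ∀ i < S.card, 1 ≤ ∑ k, π k (σ i) := fun i hi =>
    (Finset.mem_filter.mp (hσS i hi)).2
  have hsum : ∀ k, ∑ i ∈ Finset.range S.card, π k (σ i) = ∑ n ∈ Finset.range K, π k n :=
    fun k => sum_range_comp_of_image_eq hmono himage hSK _ (hzero k)
  have hchain : ∀ m n, m + 1 ≤ n → n < K → t m + dDelay a b (∑ k, π k m) ≤ t n := by
    intro m n hmn
    induction n, hmn using Nat.le_induction with
    | base => exact hc5 m
    | succ n _ ih =>
      intro hn
      have hstep := hc5 n hn
      have hnonneg := dDelay_nonneg ha hb (∑ k, π k n)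
      linarith [ih (by omega)]
  refine ⟨S.card, fun i => t (σ i), fun k i => π k (σ i), ⟨hcardpos, ?_, fun k i => h01 k (σ i),
    ?_, hσpos, fun k i hi => hc3 k (σ i) (hσK i hi), ?_, ?_, ?_⟩,
    Finset.sum_congr rfl fun k _ => hsum k⟩
  · simpa using Finset.card_le_card hSK
  · intro k
    rw [hsum]
    exact hc1 k
  · intro k i hi hki
    dsimp only at hki ⊢
    have hdeadline := hc4 k (σ i) (hσK i hi)
    rw [dDelay_sum_of_pos _ (hσpos i hi), hki] at hdeadline
    simpa using hdeadline
  · intro i hi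
    have hi' : i < S.card := by omega
    have hlt : σ i < σ (i + 1) := hmono hi' hi (Nat.lt_succ_self i)
    have hle := hchain (σ i) (σ (i + 1)) hlt (hσK _ hi)
    rwa [dDelay_sum_of_pos _ (hσpos i hi')] at hle
  · refine le_of_eq_of_le (Finset.sum_congr rfl fun k _ => ?_) hc6
    exact sum_range_comp_of_image_eq hmono himage hSK
      (fun n => (π k n : ℝ) * ℓ k / (r k * (t n - Ta k)))
      fun n hn hnS => by simp [hzero k n hn hnS]

/-- **Theorem 1.** The optimal values of Problems (P2) and (P3) coincide:
the supremum (in ℕ) of the objective over all (P2)-points equals the supremum of the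
objective over all (P3)-points, the empty schedule (objective 0) being allowed in both. -/
theorem P2_P3_same_optimal_value (K : ℕ) (hK : 0 < K) (a b B : ℝ)
    (ha : 0 < a) (hb : 0 < b) (hB : 0 < B)
    (Ta Td ℓ r : Fin K → ℝ)
    (hTa : ∀ k, 0 ≤ Ta k) (hTaTd : ∀ k, Ta k < Td k)
    (hℓ : ∀ k, 0 < ℓ k) (hr : ∀ k, 0 < r k) :
    sSup {v : ℕ | v = 0 ∨
        ∃ N t π, IsP2 K a b B Ta Td ℓ r N t π ∧ objective K N π = v}
      = sSup {v : ℕ | v = 0 ∨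
        ∃ t π, IsP3 K hK a b B Ta Td ℓ r t π ∧ objective K K π = v} := by
  congr 1
  ext v
  constructor
  · rintro (hv | ⟨N, t, π, h, rfl⟩)
    · exact Or.inl hv
    · exact Or.inr (h.exists_isP3 hK ha hb hTa hTaTd)
  · rintro (hv | ⟨t, π, h, rfl⟩)
    · exact Or.inl hv
    · by_cases hobj : objective K K π = 0
      · exact Or.inl hobj
      · exact Or.inr (h.exists_isP2 ha hb hobj)
end

section
/- If (N, t, π) is a (P2)-point with N < K, then the pair (t', π') defined by t'_n := t_n and π'_{k,n} := π_{k,n} for n ≤ N, and t'_n := Ξ and π'_{k,n} := 0 for N < n ≤ K, is a (P3)-point with the same objective value ∑_k ∑_n π'_{k,n} = ∑_k ∑_n π_{k,n}. -/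
theorem sum_range_eq_of_zero_extension {M : Type*} [AddCommMonoid M] {N K : ℕ} (hNK : N ≤ K)
    {f g : ℕ → M} (hfg : ∀ n < N, g n = f n) (hg : ∀ n, N ≤ n → g n = 0) :
    ∑ n ∈ Finset.range K, g n = ∑ n ∈ Finset.range N, f n := by
  rw [← Finset.sum_subset (Finset.range_mono hNK)
    fun n _ hn => hg n (by simpa using hn)]
  exact Finset.sum_congr rfl fun n hn => hfg n (Finset.mem_range.1 hn)

theorem le_Xi {K : ℕ} (hK : 0 < K) {a b : ℝ} (ha : 0 ≤ a) (hb : 0 ≤ b) (Td : Fin K → ℝ)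
    (k : Fin K) : Td k ≤ Xi K hK a b Td := by
  have hsup := Finset.le_sup' Td (Finset.mem_univ k)
  have : 0 ≤ a * K + b := by positivity
  unfold Xi
  linarith

/-- Every batch of a (P2)-point has finished by time `Ξ`, since it contains a task. -/
theorem IsP2.finish_le_Xi {K : ℕ} (hK : 0 < K) {a b B : ℝ} (ha : 0 ≤ a) (hb : 0 ≤ b)
    {Ta Td ℓ r : Fin K → ℝ} {N : ℕ} {t : ℕ → ℝ} {π : Fin K → ℕ → ℕ}
    (h : IsP2 K a b B Ta Td ℓ r N t π) {n : ℕ} (hn : n < N) :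
    t n + (a * (∑ k : Fin K, (π k n : ℝ)) + b) ≤ Xi K hK a b Td := by
  obtain ⟨-, -, hle, -, hne, -, hdl, -, -⟩ := h
  obtain ⟨k, -, hk⟩ := Finset.exists_ne_zero_of_sum_ne_zero
    (Nat.one_le_iff_ne_zero.1 (hne n hn))
  exact (hdl k n hn (by have := hle k n; omega)).trans (le_Xi hK ha hb Td k)

theorem dDelay_of_one_le (a b : ℝ) {m : ℕ} (hm : 1 ≤ m) : dDelay a b m = a * m + b :=
  if_neg (Nat.one_le_iff_ne_zero.1 hm)

@[simp]
theorem dDelay_zero (a b : ℝ) : dDelay a b 0 = 0 :=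
  if_pos rfl

/-- Any (P2)-point with `N < K` extends, by padding with empty batches
started at time `Ξ`, to a (P3)-point with the same objective value. -/
theorem P2_point_extends_to_P3_point (K : ℕ) (hK : 0 < K) (a b B : ℝ)
    (ha : 0 < a) (hb : 0 < b) (hB : 0 < B)
    (Ta Td ℓ r : Fin K → ℝ)
    (hTa : ∀ k, 0 ≤ Ta k) (hTaTd : ∀ k, Ta k < Td k)
    (hℓ : ∀ k, 0 < ℓ k) (hr : ∀ k, 0 < r k)
    (N : ℕ) (t : ℕ → ℝ) (π : Fin K → ℕ → ℕ)
    (hNK : N < K) (h : IsP2 K a b B Ta Td ℓ r N t π) :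
    IsP3 K hK a b B Ta Td ℓ r
        (fun n => if n < N then t n else Xi K hK a b Td)
        (fun k n => if n < N then π k n else 0)
      ∧ objective K K (fun k n => if n < N then π k n else 0) = objective K N π := by
  have hfin : ∀ n < N, _ := fun n hn => h.finish_le_Xi hK ha.le hb.le hn
  have hTd : ∀ k, 0 < Td k := fun k => (hTa k).trans_lt (hTaTd k)
  obtain ⟨-, -, hle, hone, hne, harr, hdl, hseq, hband⟩ := h
  have hdelay : ∀ n < N, dDelay a b (∑ k, π k n) = a * (∑ k, (π k n : ℝ)) + b := by
    intro n hn
    rw [dDelay_of_one_le a b (hne n hn), Nat.cast_sum]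
  have hsum : ∀ k, ∑ n ∈ Finset.range K, (if n < N then π k n else 0)
      = ∑ n ∈ Finset.range N, π k n := fun k =>
    sum_range_eq_of_zero_extension hNK.le (fun n hn => if_pos hn) fun n hn => if_neg hn.not_gt
  refine ⟨⟨fun k n => ?_, fun k => (hsum k).trans_le (hone k), fun k n _ hk => ?_,
    fun k n _ => ?_, fun n _ => ?_, ?_⟩, Finset.sum_congr rfl fun k _ => hsum k⟩
  · dsimp only
    split_ifs
    exacts [hle k n, zero_le_one]
  · dsimp only at hk ⊢
    split_ifs at hk ⊢ with hn
    exact harr k n hn hk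
  · by_cases hn : n < N
    · simp only [hn, if_true, hdelay n hn]
      obtain hk | hk : π k n = 0 ∨ π k n = 1 := by have := hle k n; omega
      · have := hfin n hn
        have := hTd k
        simp only [hk, Nat.cast_zero]
        linarith
      · simpa [hk] using hdl k n hn hk
    · simpa [hn] using (hTd k).le
  · by_cases hn : n < N
    · by_cases hn' : n + 1 < N
      · simpa only [hn, hn', if_true, hdelay n hn] using hseq n hn'
      · simpa only [hn, hn', if_true, if_false, hdelay n hn] using hfin n hn
    · have hn' : ¬ n + 1 < N := by omega
      simp [hn, hn']
  · refine le_of_eq_of_le (Finset.sum_congr rfl fun k _ => ?_) hband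
    refine sum_range_eq_of_zero_extension hNK.le (fun n hn => ?_) fun n hn => ?_
    · simp [hn]
    · simp [hn.not_gt]
end

section
/- Componentwise maximality of the recursive starting times: for every vector t ∈ ℝ^N satisfying the deadline constraints and the batch-causality constraints, and for every index n such that 𝒦_m ≠ ∅ for some m ≥ n, one has t_n ≤ t*_n. -/
/-- Auxiliary backward recursion: `tstarAux j` is the optimal starting time `t*_{N+1-j}`
of batch `N + 1 - j` (so `tstarAux 0 = t*_{N+1} = Ξ`). -/
noncomputable def tstarAux (K : ℕ) (hK : 0 < K) (a b : ℝ) (Td : Fin K → ℝ)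
    (N : ℕ) (𝒦 : ℕ → Finset (Fin K)) : ℕ → ℝ
  | 0 => Xi K hK a b Td
  | (j + 1) =>
      if h : (𝒦 (N - j)).Nonempty then
        min ((𝒦 (N - j)).inf' h Td) (tstarAux K hK a b Td N 𝒦 j)
          - dDelay a b (𝒦 (N - j)).card
      else tstarAux K hK a b Td N 𝒦 j

/-- The recursively defined batch starting times of Theorem 2:
`t*_{N+1} = Ξ` and, for `n = N, …, 1`,
`t*_n = min(χ_n, t*_{n+1}) − d_n` if `𝒦_n ≠ ∅`, and `t*_n = t*_{n+1}` otherwise. -/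
noncomputable def tstar (K : ℕ) (hK : 0 < K) (a b : ℝ) (Td : Fin K → ℝ)
    (N : ℕ) (𝒦 : ℕ → Finset (Fin K)) (n : ℕ) : ℝ :=
  tstarAux K hK a b Td N 𝒦 (N + 1 - n)

/-- Arrival constraints: `T^a_k < t_n` for all `1 ≤ n ≤ N` and all `k ∈ 𝒦_n`. -/
def ArrivalOK (K : ℕ) (Ta : Fin K → ℝ) (N : ℕ)
    (𝒦 : ℕ → Finset (Fin K)) (t : ℕ → ℝ) : Prop :=
  ∀ n ∈ Finset.Icc 1 N, ∀ k ∈ 𝒦 n, Ta k < t n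

/-- Deadline constraints: `t_n + d_n ≤ T^d_k` for all `1 ≤ n ≤ N` and all `k ∈ 𝒦_n`. -/
def DeadlineOK (K : ℕ) (a b : ℝ) (Td : Fin K → ℝ) (N : ℕ)
    (𝒦 : ℕ → Finset (Fin K)) (t : ℕ → ℝ) : Prop :=
  ∀ n ∈ Finset.Icc 1 N, ∀ k ∈ 𝒦 n, t n + dDelay a b (𝒦 n).card ≤ Td k

/-- Batch-causality constraints: `t_n + d_n ≤ t_{n+1}` for `1 ≤ n ≤ N − 1`. -/
def CausalOK (K : ℕ) (a b : ℝ) (N : ℕ)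
    (𝒦 : ℕ → Finset (Fin K)) (t : ℕ → ℝ) : Prop :=
  ∀ n, 1 ≤ n → n + 1 ≤ N → t n + dDelay a b (𝒦 n).card ≤ t (n + 1)

/-- Bandwidth constraint: `∑_{n=1}^N ∑_{k∈𝒦_n} ℓ_k/(r_k·(t_n − T^a_k)) ≤ B`. -/
def BandwidthOK (K : ℕ) (Ta ℓ r : Fin K → ℝ) (B : ℝ) (N : ℕ)
    (𝒦 : ℕ → Finset (Fin K)) (t : ℕ → ℝ) : Prop :=
  ∑ n ∈ Finset.Icc 1 N, ∑ k ∈ 𝒦 n, ℓ k / (r k * (t n - Ta k)) ≤ B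

theorem tstar_of_nonempty (K : ℕ) (hK : 0 < K) (a b : ℝ) (Td : Fin K → ℝ)
    (N : ℕ) (𝒦 : ℕ → Finset (Fin K)) {n : ℕ} (hn : n ≤ N) (h : (𝒦 n).Nonempty) :
    tstar K hK a b Td N 𝒦 n =
      min ((𝒦 n).inf' h Td) (tstar K hK a b Td N 𝒦 (n + 1)) - dDelay a b (𝒦 n).card := by
  obtain ⟨j, rfl⟩ := Nat.exists_eq_add_of_le hn
  have h₁ : n + j + 1 - n = j + 1 := by omega
  have h₂ : n + j + 1 - (n + 1) = j := by omega
  have h₃ : n + j - j = n := by omega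
  simp only [tstar, h₁, h₂, tstarAux, h₃, h, dif_pos]

theorem tstar_of_empty (K : ℕ) (hK : 0 < K) (a b : ℝ) (Td : Fin K → ℝ)
    (N : ℕ) (𝒦 : ℕ → Finset (Fin K)) {n : ℕ} (hn : n ≤ N) (h : ¬ (𝒦 n).Nonempty) :
    tstar K hK a b Td N 𝒦 n = tstar K hK a b Td N 𝒦 (n + 1) := by
  obtain ⟨j, rfl⟩ := Nat.exists_eq_add_of_le hn
  have h₁ : n + j + 1 - n = j + 1 := by omega
  have h₂ : n + j + 1 - (n + 1) = j := by omega
  have h₃ : n + j - j = n := by omega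
  simp only [tstar, h₁, h₂, tstarAux, h₃, h, dif_neg, not_false_eq_true]

/-- If every batch from `n` on is empty, the recursion has not left its initial value. -/
theorem tstar_eq_Xi_of_forall_empty (K : ℕ) (hK : 0 < K) (a b : ℝ) (Td : Fin K → ℝ)
    (N : ℕ) (𝒦 : ℕ → Finset (Fin K)) {n : ℕ} (hn : n ≤ N + 1)
    (h : ∀ m, n ≤ m → m ≤ N → ¬ (𝒦 m).Nonempty) :
    tstar K hK a b Td N 𝒦 n = Xi K hK a b Td := by
  induction hn using Nat.decreasingInduction with
  | self => simp [tstar, tstarAux]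
  | of_succ n hn ih =>
    rw [tstar_of_empty K hK a b Td N 𝒦 (by omega) (h n le_rfl (by omega))]
    exact ih fun m hm => h m (by omega)

theorem deadline_le_Xi (K : ℕ) (hK : 0 < K) {a b : ℝ} (ha : 0 ≤ a) (hb : 0 ≤ b)
    (Td : Fin K → ℝ) (k : Fin K) : Td k ≤ Xi K hK a b Td := by
  have h₁ : Td k ≤ Finset.univ.sup' (Finset.univ_nonempty_iff.mpr ⟨⟨0, hK⟩⟩) Td :=
    Finset.le_sup' Td (Finset.mem_univ k)
  have h₂ : 0 ≤ a * K + b := by positivity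
  unfold Xi
  linarith

/-- Componentwise maximality of the recursive starting times: for every
starting-time vector `t` satisfying the deadline and batch-causality constraints, and every
batch index `n ∈ {1,…,N}` such that some batch `𝒦_m` with `n ≤ m ≤ N` is nonempty, one has
`t_n ≤ t*_n`. -/
theorem tstar_componentwise_maximal (K : ℕ) (hK : 0 < K) (a b : ℝ)
    (ha : 0 < a) (hb : 0 < b)
    (Ta Td : Fin K → ℝ) (hTa : ∀ k, 0 ≤ Ta k) (hTaTd : ∀ k, Ta k < Td k)
    (N : ℕ) (hN : 1 ≤ N) (𝒦 : ℕ → Finset (Fin K))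
    (hdisj : ∀ m ∈ Finset.Icc 1 N, ∀ n ∈ Finset.Icc 1 N, m ≠ n → Disjoint (𝒦 m) (𝒦 n))
    (t : ℕ → ℝ)
    (hdead : DeadlineOK K a b Td N 𝒦 t)
    (hcaus : CausalOK K a b N 𝒦 t) :
    ∀ n ∈ Finset.Icc 1 N, (∃ m, n ≤ m ∧ m ≤ N ∧ (𝒦 m).Nonempty) →
      t n ≤ tstar K hK a b Td N 𝒦 n := by
  intro n hn
  obtain ⟨hn₁, hnN⟩ := Finset.mem_Icc.mp hn
  clear hn
  replace hnN : n ≤ N + 1 := by omega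
  induction hnN using Nat.decreasingInduction with
  | self => rintro ⟨m, hm, hmN, -⟩; omega
  | of_succ n hn ih =>
    replace ih := ih (by omega)
    rintro ⟨m, hnm, hmN, hm⟩
    by_cases h : (𝒦 n).Nonempty
    · rw [tstar_of_nonempty K hK a b Td N 𝒦 (by omega) h, le_sub_iff_add_le]
      have hd := hdead n (Finset.mem_Icc.mpr ⟨hn₁, by omega⟩)
      refine le_min (Finset.le_inf' h Td hd) ?_
      by_cases hlater : ∃ m, n + 1 ≤ m ∧ m ≤ N ∧ (𝒦 m).Nonempty
      · obtain ⟨m', hm', hm'N, -⟩ := id hlater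
        exact (hcaus n hn₁ (by omega)).trans (ih hlater)
      · rw [tstar_eq_Xi_of_forall_empty K hK a b Td N 𝒦 (by omega)
          fun m h₁ h₂ h₃ => hlater ⟨m, h₁, h₂, h₃⟩]
        obtain ⟨k, hk⟩ := h
        exact (hd k hk).trans (deadline_le_Xi K hK ha.le hb.le Td k)
    · have hne : n ≠ m := by
        rintro rfl
        exact h hm
      rw [tstar_of_empty K hK a b Td N 𝒦 (by omega) h]
      have hc := hcaus n hn₁ (by omega)
      rw [Finset.not_nonempty_iff_eq_empty.mp h] at hc
      simp only [dDelay, Finset.card_empty, if_true, add_zero] at hc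
      exact hc.trans (ih ⟨m, by omega, hmN, hm⟩)
end

section
/- Latest-start monotone feasibility for a single batch with fixed task set: fix a finite task set 𝒦' ⊆ {1,…,K} with |𝒦'| = Π and a completion bound T ∈ ℝ, and suppose t₀ ∈ ℝ satisfies (i) T^a_k < t₀ for all k ∈ 𝒦', (ii) t₀ + d(Π) ≤ T, and (iii) ∑_{k∈𝒦'} ℓ_k/(r_k·(t₀ − T^a_k)) ≤ B. Then for every t₁ with t₀ ≤ t₁ ≤ T − d(Π), constraints (i)–(iii) also hold at t₁. In particular, constraints (i)–(iii) are satisfiable for some t ∈ ℝ if and only if they are satisfied at t = T − d(Π). -/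
/-- Latest-start monotone feasibility for a single batch with fixed task
set `𝒦'` of size `Π` and completion bound `T`: if `t₀` satisfies
(i) `T^a_k < t₀` for `k ∈ 𝒦'`, (ii) `t₀ + d(Π) ≤ T`, (iii) the bandwidth constraint,
then every `t₁` with `t₀ ≤ t₁ ≤ T − d(Π)` also satisfies (i)–(iii); in particular,
(i)–(iii) are satisfiable for some `t` iff they hold at `t = T − d(Π)`. -/
theorem single_batch_latest_start (K : ℕ) (hK : 0 < K) (a b B : ℝ)
    (ha : 0 < a) (hb : 0 < b) (hB : 0 < B)
    (Ta ℓ r : Fin K → ℝ) (hℓ : ∀ k, 0 < ℓ k) (hr : ∀ k, 0 < r k)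
    (𝒦' : Finset (Fin K)) (P : ℕ) (hcard : 𝒦'.card = P) (T : ℝ) :
    (∀ t₀ : ℝ,
      ((∀ k ∈ 𝒦', Ta k < t₀) ∧ t₀ + dDelay a b P ≤ T ∧
        ∑ k ∈ 𝒦', ℓ k / (r k * (t₀ - Ta k)) ≤ B) →
      ∀ t₁ : ℝ, t₀ ≤ t₁ → t₁ ≤ T - dDelay a b P →
        ((∀ k ∈ 𝒦', Ta k < t₁) ∧ t₁ + dDelay a b P ≤ T ∧
          ∑ k ∈ 𝒦', ℓ k / (r k * (t₁ - Ta k)) ≤ B)) ∧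
    ((∃ t : ℝ, (∀ k ∈ 𝒦', Ta k < t) ∧ t + dDelay a b P ≤ T ∧
        ∑ k ∈ 𝒦', ℓ k / (r k * (t - Ta k)) ≤ B) ↔
      ((∀ k ∈ 𝒦', Ta k < T - dDelay a b P) ∧
        (T - dDelay a b P) + dDelay a b P ≤ T ∧
        ∑ k ∈ 𝒦', ℓ k / (r k * ((T - dDelay a b P) - Ta k)) ≤ B)) := by
  have mono : ∀ t₀ : ℝ,
      ((∀ k ∈ 𝒦', Ta k < t₀) ∧ t₀ + dDelay a b P ≤ T ∧
        ∑ k ∈ 𝒦', ℓ k / (r k * (t₀ - Ta k)) ≤ B) →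
      ∀ t₁ : ℝ, t₀ ≤ t₁ → t₁ ≤ T - dDelay a b P →
        ((∀ k ∈ 𝒦', Ta k < t₁) ∧ t₁ + dDelay a b P ≤ T ∧
          ∑ k ∈ 𝒦', ℓ k / (r k * (t₁ - Ta k)) ≤ B) := by
    rintro t₀ ⟨harr, -, hband⟩ t₁ h01 h1T
    refine ⟨fun k hk => (harr k hk).trans_le h01, by linarith, le_trans ?_ hband⟩
    refine Finset.sum_le_sum fun k hk => ?_
    exact div_le_div_of_nonneg_left (hℓ k).le (mul_pos (hr k) (sub_pos.2 (harr k hk)))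
      (mul_le_mul_of_nonneg_left (sub_le_sub_right h01 _) (hr k).le)
  refine ⟨mono, ?_, fun h => ⟨_, h⟩⟩
  rintro ⟨t, ht⟩
  exact mono t ht _ (by linarith [ht.2.1]) le_rfl
end

section
/- Correctness of the greedy feasibility test in the spectrum-hole allocation algorithm: fix Π ∈ ℕ and a target completion deadline T^d ∈ ℝ with T^d ≤ min( min_{k∈S} T^d_k, t_{n+2} ), set t := T^d − d(Π + |S|), and assume t̄_n + d(m_n) < t and T^a_k < t for all k ∈ S. Define S̃ := {k ∈ F : T^a_k < t and T^d_k ≥ T^d} and, for k ∈ S̃ ∪ S, the required bandwidth w_k := ℓ̃_k/(r_k·(t − max(T^a_k, t̄_n))). Then there exists 𝒦' ⊆ F with |𝒦'| = Π such that every k ∈ 𝒦' satisfies T^a_k < t and T^d_k ≥ T^d and ∑_{k∈𝒦'∪S} w_k ≤ B̄, if and only if |S̃| ≥ Π and (the sum of the Π smallest values of w on S̃) + ∑_{k∈S} w_k ≤ B̄. -/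
/-- The sum of the `P` smallest values of `f` on the finite set `S`: enumerate the
multiset `{f(k) : k ∈ S}` in nondecreasing order and sum the first `P` entries. -/
noncomputable def sumSmallest {ι : Type*} (S : Finset ι) (f : ι → ℝ) (P : ℕ) : ℝ :=
  (((S.val.map f).sort (· ≤ ·)).take P).sum

theorem List.Pairwise.sum_take_le_sum_of_sublist {l m : List ℝ} (hl : l.Pairwise (· ≤ ·))
    (h : m.Sublist l) : (l.take m.length).sum ≤ m.sum := by
  induction l generalizing m with
  | nil => simp [List.sublist_nil.mp h]
  | cons a l ih =>
    cases m with
    | nil => simp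
    | cons x m =>
      rw [List.pairwise_cons] at hl
      have hax : a ≤ x := by
        rcases List.mem_cons.mp (h.subset List.mem_cons_self) with rfl | hx
        · exact le_rfl
        · exact hl.1 x hx
      have hm : m.Sublist l := h.tail
      simpa using add_le_add hax (ih hl.2 hm)

theorem sumSmallest_card_le_sum {ι : Type*} {s T : Finset ι} (f : ι → ℝ) (h : T ⊆ s) :
    sumSmallest s f T.card ≤ ∑ k ∈ T, f k := by
  have hsub : ((T.val.map f).sort (· ≤ ·)).Sublist ((s.val.map f).sort (· ≤ ·)) := by
    apply List.sublist_of_subperm_of_pairwise (r := (· ≤ ·))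
    · rw [← Multiset.coe_le, Multiset.sort_eq, Multiset.sort_eq]
      exact Multiset.map_le_map (Finset.val_le_iff.mpr h)
    · exact Multiset.pairwise_sort _ _
    · exact Multiset.pairwise_sort _ _
  have key := (Multiset.pairwise_sort (s.val.map f) (· ≤ ·)).sum_take_le_sum_of_sublist hsub
  rwa [Multiset.length_sort, Multiset.card_map, ← Multiset.sum_coe (Multiset.sort _ _),
    Multiset.sort_eq] at key

theorem exists_subset_sum_eq_sumSmallest {ι : Type*} (s : Finset ι) (f : ι → ℝ) {n : ℕ}
    (hn : n ≤ s.card) : ∃ T ⊆ s, T.card = n ∧ ∑ k ∈ T, f k = sumSmallest s f n := by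
  have hperm : ((s.val.map f).sort (· ≤ ·)).Perm (s.toList.map f) := by
    rw [← Multiset.coe_eq_coe, Multiset.sort_eq, ← Multiset.map_coe, Finset.coe_toList]
  obtain ⟨l, hl, hls⟩ := (List.take_sublist n _).subperm.trans hperm.subperm
  obtain ⟨m, hm, rfl⟩ := List.sublist_map_iff.mp hls
  refine ⟨⟨m, Multiset.coe_nodup.mpr (s.nodup_toList.sublist hm)⟩, fun k hk => ?_, ?_, ?_⟩
  · exact Finset.mem_toList.mp (hm.subset hk)
  · simpa [hn] using hl.length_eq
  · exact hl.sum_eq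

/-- Correctness of the greedy feasibility test in the spectrum-hole
allocation algorithm: with target completion deadline `T^d ≤ min(min_{k∈S} T^d_k, t_{n+2})`,
batch start `t = T^d − d(P + |S|)`, candidate set
`S̃ = {k ∈ F : T^a_k < t and T^d_k ≥ T^d}` and required bandwidths
`w_k = ℓ̃_k/(r_k·(t − max(T^a_k, t̄_n)))`, a set `𝒦' ⊆ F` of `P` new tasks respecting
arrival/deadline and total bandwidth `B̄` exists iff `|S̃| ≥ P` and the sum of the `P`
smallest values of `w` on `S̃` plus `∑_{k∈S} w_k` is at most `B̄`. -/
theorem greedy_hole_feasibility_test {ι : Type*} [DecidableEq ι] (F S : Finset ι)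
    (hFS : Disjoint F S) (Ta Td ℓ r : ι → ℝ)
    (hℓ : ∀ k ∈ F ∪ S, 0 < ℓ k) (hr : ∀ k ∈ F ∪ S, 0 < r k)
    (tbar tnext Bbar : ℝ) (hB : 0 < Bbar) (mprev : ℕ) (a b : ℝ)
    (ha : 0 < a) (hb : 0 < b)
    (P : ℕ) (Tdl : ℝ)
    (hTdlS : ∀ k ∈ S, Tdl ≤ Td k) (hTdlnext : Tdl ≤ tnext)
    (t : ℝ) (ht : t = Tdl - dDelay a b (P + S.card))
    (hprev : tbar + dDelay a b mprev < t)
    (harrS : ∀ k ∈ S, Ta k < t)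
    (w : ι → ℝ) (hw : ∀ k, w k = ℓ k / (r k * (t - max (Ta k) tbar)))
    (St : Finset ι) (hSt : ∀ k, k ∈ St ↔ k ∈ F ∧ Ta k < t ∧ Tdl ≤ Td k) :
    (∃ 𝒦' ⊆ F, 𝒦'.card = P ∧ (∀ k ∈ 𝒦', Ta k < t ∧ Tdl ≤ Td k) ∧
        ∑ k ∈ 𝒦' ∪ S, w k ≤ Bbar) ↔
      (P ≤ St.card ∧ sumSmallest St w P + ∑ k ∈ S, w k ≤ Bbar) := by
  constructor
  · rintro ⟨T, hTF, rfl, hT, hsum⟩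
    have hTS : T ⊆ St := fun k hk => (hSt k).mpr ⟨hTF hk, hT k hk⟩
    rw [Finset.sum_union (Finset.disjoint_of_subset_left hTF hFS)] at hsum
    exact ⟨Finset.card_le_card hTS,
      (add_le_add_left (sumSmallest_card_le_sum w hTS) _).trans hsum⟩
  · rintro ⟨hP, hsum⟩
    obtain ⟨T, hTS, hcard, hT⟩ := exists_subset_sum_eq_sumSmallest St w hP
    have hTF : T ⊆ F := fun k hk => ((hSt k).mp (hTS hk)).1
    refine ⟨T, hTF, hcard, fun k hk => ((hSt k).mp (hTS hk)).2, ?_⟩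
    rwa [Finset.sum_union (Finset.disjoint_of_subset_left hTF hFS), hT]
end
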